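/- arXiv:math/0006228 — 2 statements merged into one kernel-verified Lean document; each statement's English description precedes it below -/
import Mathlib

section
/- For every real number λ, the symmetric bilinear form B on ℝ³ ⊕ ℝ³ determined by B(J_a,P_b) = δ_{ab}, B(J_a,J_b) = B(P_a,P_b) = 0 is nondegenerate and is invariant under the adjoint action of the λ-deformed Lie algebra, i.e. B([X,Y],Z) + B(Y,[X,Z]) = 0 for all X, Y, Z. -/
open scoped BigOperators

/-- ℝ³, realised as functions `Fin 3 → ℝ`. -/
abbrev V3 : Type := Fin 3 → ℝ

/-- The basis elements `J_a = (e_a, 0)` of ℝ³ ⊕ ℝ³. -/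
def Jb (a : Fin 3) : V3 × V3 := (Pi.single a 1, 0)

/-- The basis elements `P_a = (0, e_a)` of ℝ³ ⊕ ℝ³. -/
def Pb (a : Fin 3) : V3 × V3 := (0, Pi.single a 1)

/-- The λ-deformed bracket `[(j₁,p₁),(j₂,p₂)] = (j₁×j₂ + λ p₁×p₂, j₁×p₂ − j₂×p₁)`,
which realises `[J_a,J_b] = ε_{abc}J_c`, `[J_a,P_b] = ε_{abc}P_c`, `[P_a,P_b] = λ ε_{abc}J_c`. -/
def gBracket (lam : ℝ) (x y : V3 × V3) : V3 × V3 :=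
  (crossProduct x.1 y.1 + lam • crossProduct x.2 y.2,
    crossProduct x.1 y.2 - crossProduct y.1 x.2)

/-- The symmetric bilinear form with `B(J_a,P_b) = δ_{ab}`, `B(J_a,J_b) = B(P_a,P_b) = 0`. -/
def Bform (x y : V3 × V3) : ℝ := (∑ i, x.1 i * y.2 i) + (∑ i, x.2 i * y.1 i)

/-- For every real λ, the symmetric bilinear form `B` determined by `B(J_a,P_b) = δ_{ab}`,
`B(J_a,J_b) = B(P_a,P_b) = 0` is nondegenerate and invariant under the adjoint action of the
λ-deformed Lie algebra: `B([X,Y],Z) + B(Y,[X,Z]) = 0` for all `X, Y, Z`. -/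
theorem Bform_nondegenerate_invariant (lam : ℝ) :
    (∀ x y : V3 × V3, Bform x y = Bform y x) ∧
    (∀ a b : Fin 3, Bform (Jb a) (Pb b) = if a = b then 1 else 0) ∧
    (∀ a b : Fin 3, Bform (Jb a) (Jb b) = 0) ∧
    (∀ a b : Fin 3, Bform (Pb a) (Pb b) = 0) ∧
    (∀ x : V3 × V3, (∀ y : V3 × V3, Bform x y = 0) → x = 0) ∧
    (∀ X Y Z : V3 × V3, Bform (gBracket lam X Y) Z + Bform Y (gBracket lam X Z) = 0) := by
  refine ⟨fun x y => ?_, fun a b => ?_, fun a b => ?_, fun a b => ?_, fun x h => ?_,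
    fun X Y Z => ?_⟩
  · simp only [Bform, mul_comm (y.1 _), mul_comm (y.2 _)]
    exact add_comm _ _
  · simp [Bform, Jb, Pb, Pi.single_apply, eq_comm]
  · simp [Bform, Jb]
  · simp [Bform, Pb]
  · ext i
    · simpa [Bform, Pb, Pi.single_apply] using h (Pb i)
    · simpa [Bform, Jb, Pi.single_apply] using h (Jb i)
  · simp only [Bform, gBracket, cross_apply, Fin.sum_univ_three, Pi.add_apply, Pi.sub_apply,
      Pi.smul_apply, smul_eq_mul, Matrix.cons_val]
    ring
end

section
/- The element r = Σ_a P_a ⊗ J_a ∈ iso(3) ⊗ iso(3) satisfies the classical Yang–Baxter equation: [[r,r]] := [r₁₂,r₁₃] + [r₁₂,r₂₃] + [r₁₃,r₂₃] = 0 in iso(3) ⊗ iso(3) ⊗ iso(3), where for r = Σ r^{αβ} X_α ⊗ X_β one sets [r₁₂,r₁₃] = Σ r^{αβ}r^{γδ}[X_α,X_γ] ⊗ X_β ⊗ X_δ, [r₁₂,r₂₃] = Σ r^{αβ}r^{γδ} X_α ⊗ [X_β,X_γ] ⊗ X_δ, and [r₁₃,r₂₃] = Σ r^{αβ}r^{γδ}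 X_α ⊗ X_γ ⊗ [X_β,X_δ]. -/
open scoped BigOperators TensorProduct

/-- The `iso(3)` bracket: `[J_a,J_b] = ε_{abc}J_c`, `[J_a,P_b] = ε_{abc}P_c`,
`[P_a,P_b] = 0`; equivalently `[(j₁,p₁),(j₂,p₂)] = (j₁×j₂, j₁×p₂ − j₂×p₁)`. -/
def isoBracket (x y : V3 × V3) : V3 × V3 :=
  (crossProduct x.1 y.1, crossProduct x.1 y.2 - crossProduct y.1 x.2)

theorem isoBracket_Pb_Pb (a b : Fin 3) : isoBracket (Pb a) (Pb b) = 0 := by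
  simp [isoBracket, Pb]

/-- The structure constants `ε_{abc}`, as coordinates of `e_a × e_b`. -/
def epsilon (a b c : Fin 3) : ℝ :=
  crossProduct (Pi.single a 1 : V3) (Pi.single b 1) c

theorem epsilon_swap_right (a b c : Fin 3) : epsilon a c b = -epsilon a b c := by
  fin_cases a <;> fin_cases b <;> fin_cases c <;> simp [epsilon, cross_apply]

theorem isoBracket_Jb_Pb (a b : Fin 3) :
    isoBracket (Jb a) (Pb b) = ∑ c, epsilon a b c • Pb c := by
  ext i <;> fin_cases i <;> simp [isoBracket, Jb, Pb, epsilon, Fin.sum_univ_three]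

theorem isoBracket_Jb_Jb (a b : Fin 3) :
    isoBracket (Jb a) (Jb b) = ∑ c, epsilon a b c • Jb c := by
  ext i <;> fin_cases i <;> simp [isoBracket, Jb, epsilon, Fin.sum_univ_three]

/-- The classical r-matrix `r = Σ_a P_a ⊗ J_a ∈ iso(3) ⊗ iso(3)` satisfies the classical
Yang–Baxter equation `[[r,r]] = [r₁₂,r₁₃] + [r₁₂,r₂₃] + [r₁₃,r₂₃] = 0`, where for
`r = Σ P_a ⊗ J_a` one has `[r₁₂,r₁₃] = Σ [P_a,P_b] ⊗ J_a ⊗ J_b`,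
`[r₁₂,r₂₃] = Σ P_a ⊗ [J_a,P_b] ⊗ J_b` and `[r₁₃,r₂₃] = Σ P_a ⊗ P_b ⊗ [J_a,J_b]`. -/
theorem classical_r_matrix_CYBE :
    (∑ a : Fin 3, ∑ b : Fin 3,
        isoBracket (Pb a) (Pb b) ⊗ₜ[ℝ] (Jb a ⊗ₜ[ℝ] Jb b))
      + (∑ a : Fin 3, ∑ b : Fin 3,
          Pb a ⊗ₜ[ℝ] (isoBracket (Jb a) (Pb b) ⊗ₜ[ℝ] Jb b))
      + (∑ a : Fin 3, ∑ b : Fin 3,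
          Pb a ⊗ₜ[ℝ] (Pb b ⊗ₜ[ℝ] isoBracket (Jb a) (Jb b)))
      = (0 : (V3 × V3) ⊗[ℝ] ((V3 × V3) ⊗[ℝ] (V3 × V3))) := by
  simp only [isoBracket_Pb_Pb, isoBracket_Jb_Pb, isoBracket_Jb_Jb, TensorProduct.zero_tmul,
    Finset.sum_const_zero, zero_add, TensorProduct.sum_tmul, TensorProduct.tmul_sum,
    ← TensorProduct.smul_tmul', TensorProduct.tmul_smul]
  rw [← Finset.sum_add_distrib]
  refine Finset.sum_eq_zero fun a _ => ?_
  rw [Finset.sum_comm, ← Finset.sum_add_distrib]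
  refine Finset.sum_eq_zero fun b _ => ?_
  rw [← Finset.sum_add_distrib]
  refine Finset.sum_eq_zero fun c _ => ?_
  rw [epsilon_swap_right a b c, ← add_smul, neg_add_cancel, zero_smul]
end
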